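/- Let a > 0 and m ∈ ℕ. Let U ∈ C^{m+1}([0,a]) with U(0) = 0 be such that (i) 0 is a strict minimum of U on [0,a], i.e. U(t) > 0 for all t ∈ (0,a], and (ii) U^{(m)}(0) > 0 and U^{(j)}(0) = 0 for all j ∈ {1,…,m−1}. Let D be the Dirichlet Laplacian in L²(0,a). Then for every n ∈ ℕ, as α → +∞, E_n(D + αU) = (U^{(m)}(0)/m!)^{2/(2+m)} E_n(S_{m,1}) α^{2/(2+m)} + O(α^{2/(3+m)}). -/

import Mathlib

open MeasureTheory Set Filter Topology

noncomputable section

/-- Courant–Fischer min–max value of index `n` (the `n`-th eigenvalue, `n ≥ 1`, counted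
with multiplicities) of the quadratic form `q` defined on the form core `dom`, relative
to the squared-`L²`-norm form `N`, inside an ambient real vector space `H`. -/
def minmaxE {H : Type*} [AddCommGroup H] [Module ℝ H]
    (dom : Set H) (N q : H → ℝ) (n : ℕ) : ℝ :=
  sInf {E : ℝ | ∃ V : Submodule ℝ H, (V : Set H) ⊆ dom ∧ Module.finrank ℝ ↥V = n ∧
    (∀ u ∈ V, N u = 0 → u = 0) ∧ ∀ u ∈ V, q u ≤ E * N u}

/-- Form core for the operators `S_{m,β}` on `(0,+∞)` (Dirichlet at `0`). -/
def domS : Set (ℝ → ℝ) :=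
  {f | ContDiff ℝ 1 f ∧ HasCompactSupport f ∧ ∀ t ≤ (0:ℝ), f t = 0}

/-- Squared `L²(0,∞)`-norm. -/
def NS (f : ℝ → ℝ) : ℝ := ∫ t in Set.Ioi (0:ℝ), (f t) ^ 2

/-- The form of `S_{m,β} = -d²/dt² + β t^m` on `(0,∞)` with Dirichlet condition at `0`. -/
def qS (m : ℕ) (β : ℝ) (f : ℝ → ℝ) : ℝ :=
  ∫ t in Set.Ioi (0:ℝ), ((deriv f t) ^ 2 + β * t ^ m * (f t) ^ 2)

/-- `E_n(S_{m,β})`. -/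
def ES (m : ℕ) (β : ℝ) (n : ℕ) : ℝ := minmaxE domS NS (qS m β) n

/-- Form core for the Dirichlet Laplacian on `(0,a)`. -/
def domDir (a : ℝ) : Set (ℝ → ℝ) := {f | ContDiff ℝ 1 f ∧ ∀ t, t ∉ Set.Ioo (0:ℝ) a → f t = 0}

/-- Squared `L²(0,a)`-norm. -/
def NDir (a : ℝ) (f : ℝ → ℝ) : ℝ := ∫ t in (0:ℝ)..a, (f t) ^ 2

/-- The form of the Schrödinger operator `D + αU` on `(0,a)` with Dirichlet conditions. -/
def qDir (a : ℝ) (U : ℝ → ℝ) (α : ℝ) (f : ℝ → ℝ) : ℝ :=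
  ∫ t in (0:ℝ)..a, ((deriv f t) ^ 2 + α * U t * (f t) ^ 2)

/-- `E_n(D + αU)` for the Dirichlet Schrödinger operator on `(0,a)`. -/
def EDU (a : ℝ) (U : ℝ → ℝ) (α : ℝ) (n : ℕ) : ℝ := minmaxE (domDir a) (NDir a) (qDir a U α) n

end

noncomputable section

/-- The bounds `E` admitted by some `n`-dimensional test space; `minmaxE` is their infimum. -/
def minmaxSet {H : Type*} [AddCommGroup H] [Module ℝ H]
    (dom : Set H) (N q : H → ℝ) (n : ℕ) : Set ℝ :=
  {E : ℝ | ∃ V : Submodule ℝ H, (V : Set H) ⊆ dom ∧ Module.finrank ℝ ↥V = n ∧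
    (∀ u ∈ V, N u = 0 → u = 0) ∧ ∀ u ∈ V, q u ≤ E * N u}

theorem mem_minmaxSet_of_linearMap {H H' : Type*} [AddCommGroup H] [Module ℝ H]
    [AddCommGroup H'] [Module ℝ H'] {dom : Set H} {dom' : Set H'} {N q : H → ℝ} {N' q' : H' → ℝ}
    {n : ℕ} {E E' : ℝ} (T : H →ₗ[ℝ] H') (hdom : ∀ u ∈ dom, T u ∈ dom')
    (hN' : ∀ v ∈ dom', N' v = 0 → v = 0)
    (hT : ∀ u ∈ dom, q u ≤ E * N u → q' (T u) ≤ E' * N' (T u))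
    (hinj : ∀ u ∈ dom, q u ≤ E * N u → T u = 0 → N u = 0)
    (hE : E ∈ minmaxSet dom N q n) : E' ∈ minmaxSet dom' N' q' n := by
  obtain ⟨V, hV, hfin, hN, hq⟩ := hE
  refine ⟨V.map T, ?_, ?_, ?_, ?_⟩
  · rintro _ ⟨u, hu, rfl⟩
    exact hdom u (hV hu)
  · have hker : Function.Injective (T.domRestrict V) := by
      rw [← LinearMap.ker_eq_bot, LinearMap.ker_eq_bot']
      rintro ⟨u, hu⟩ h
      exact Subtype.ext (hN u hu (hinj u (hV hu) (hq u hu) h))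
    rw [← hfin, ← LinearMap.finrank_range_of_inj hker, LinearMap.range_domRestrict]
  · rintro _ ⟨u, hu, rfl⟩
    exact hN' _ (hdom u (hV hu))
  · rintro _ ⟨u, hu, rfl⟩
    exact hT u (hV hu) (hq u hu)

theorem nonneg_of_mem_minmaxSet {H : Type*} [AddCommGroup H] [Module ℝ H]
    {dom : Set H} {N q : H → ℝ} {n : ℕ} (hn : 1 ≤ n) (hN : ∀ u, 0 ≤ N u)
    (hq : ∀ u ∈ dom, 0 ≤ q u) {E : ℝ} (hE : E ∈ minmaxSet dom N q n) : 0 ≤ E := by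
  obtain ⟨V, hV, hfin, hN0, hqE⟩ := hE
  have : Nontrivial V := Module.nontrivial_of_finrank_pos (R := ℝ) (by omega)
  obtain ⟨⟨u, hu⟩, hne⟩ := exists_ne (0 : V)
  have hne' : N u ≠ 0 := fun h => hne (Subtype.ext (hN0 u hu h))
  have hpos : 0 < N u := lt_of_le_of_ne (hN u) hne'.symm
  exact nonneg_of_mul_nonneg_left ((hq u (hV hu)).trans (hqE u hu)) hpos

theorem csInf_le_csInf_add {S T : Set ℝ} {M d : ℝ} (hS : S.Nonempty)
    (hT : BddBelow T) (hlt : sInf S < M) (h : ∀ E ∈ S, E < M → E + d ∈ T) :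
    T.Nonempty ∧ sInf T ≤ sInf S + d := by
  obtain ⟨E₀, hE₀, hE₀M⟩ := exists_lt_of_csInf_lt hS hlt
  refine ⟨⟨_, h E₀ hE₀ hE₀M⟩, le_of_forall_pos_lt_add fun r hr => ?_⟩
  obtain ⟨E, hE, hEr⟩ := exists_lt_of_csInf_lt hS
    (lt_min hlt (lt_add_of_pos_right (sInf S) hr))
  have := csInf_le hT (h E hE (hEr.trans_le (min_le_left _ _)))
  linarith [hEr.trans_le (min_le_right _ _)]

/-- The form of `-d²/dt² + W` on `(0,∞)`. -/
def schrodingerForm (W f : ℝ → ℝ) : ℝ :=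
  ∫ t in Set.Ioi (0 : ℝ), ((deriv f t) ^ 2 + W t * (f t) ^ 2)

theorem hasCompactSupport_sq {f : ℝ → ℝ} (hf : HasCompactSupport f) :
    HasCompactSupport (fun t => (f t) ^ 2) := by
  simp only [sq]
  exact hf.mul_right

theorem integrableOn_sq_of_mem_domS {f : ℝ → ℝ} (hf : f ∈ domS) :
    IntegrableOn (fun t => (f t) ^ 2) (Set.Ioi 0) :=
  ((hf.1.continuous.pow 2).integrable_of_hasCompactSupport
    (hasCompactSupport_sq hf.2.1)).integrableOn

theorem integrableOn_schrodingerForm {W f : ℝ → ℝ} (hW : Continuous W) (hf : f ∈ domS) :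
    IntegrableOn (fun t => (deriv f t) ^ 2 + W t * (f t) ^ 2) (Set.Ioi 0) := by
  refine Integrable.integrableOn (Integrable.add ?_ ?_)
  · exact ((hf.1.continuous_deriv le_rfl).pow 2).integrable_of_hasCompactSupport
      (hasCompactSupport_sq hf.2.1.deriv)
  · exact (hW.mul (hf.1.continuous.pow 2)).integrable_of_hasCompactSupport
      (hasCompactSupport_sq hf.2.1).mul_left

theorem NS_nonneg (f : ℝ → ℝ) : 0 ≤ NS f :=
  integral_nonneg fun _ => sq_nonneg _

theorem eq_zero_of_NS_eq_zero {f : ℝ → ℝ} (hf : f ∈ domS) (h : NS f = 0) : f = 0 := by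
  have hzero : (fun t => (f t) ^ 2) =ᵐ[volume.restrict (Set.Ioi 0)] 0 :=
    (integral_eq_zero_iff_of_nonneg (fun _ => sq_nonneg _)
      (integrableOn_sq_of_mem_domS hf)).1 h
  have hall : ∀ᵐ t : ℝ, f t = 0 := by
    rw [Filter.EventuallyEq, ae_restrict_iff' measurableSet_Ioi] at hzero
    filter_upwards [hzero] with t ht
    rcases le_or_gt t 0 with h0 | h0
    · exact hf.2.2 t h0
    · simpa using ht h0
  exact Continuous.ae_eq_iff_eq (volume : Measure ℝ) hf.1.continuous continuous_const |>.1 hall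

theorem schrodingerForm_nonneg {W : ℝ → ℝ} (hW : ∀ t, 0 < t → 0 ≤ W t) (f : ℝ → ℝ) :
    0 ≤ schrodingerForm W f :=
  setIntegral_nonneg measurableSet_Ioi fun t ht =>
    add_nonneg (sq_nonneg _) (mul_nonneg (hW t ht) (sq_nonneg _))

/-- Comparison of two Schrödinger forms under the IMS localization `u ↦ cos θ · u`. -/
theorem schrodingerForm_cos_mul_le {W₁ W₂ θ u : ℝ → ℝ} {δ κ ε M : ℝ}
    (hW₁ : Continuous W₁) (hW₂ : Continuous W₂) (hθ : ContDiff ℝ 1 θ)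
    (hθ0 : ∀ t ≤ δ / 2, θ t = 0) (hθ1 : ∀ t, δ ≤ t → θ t = Real.pi / 2)
    (hκ : ∀ t, (deriv θ t) ^ 2 ≤ κ)
    (hM : ∀ t, δ / 2 ≤ t → M ≤ W₁ t) (hW : ∀ t, 0 < t → t ≤ δ → W₂ t ≤ W₁ t + ε)
    (hu : u ∈ domS) :
    schrodingerForm W₂ (fun t => Real.cos (θ t) * u t) ≤ schrodingerForm W₁ u + κ * NS u
      + ε * NS (fun t => Real.cos (θ t) * u t) - M * NS (fun t => Real.sin (θ t) * u t) := by
  have hc : (fun t => Real.cos (θ t) * u t) ∈ domS :=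
    ⟨hθ.cos.mul hu.1, hu.2.1.mul_left, fun t ht => by simp [hu.2.2 t ht]⟩
  have hs : (fun t => Real.sin (θ t) * u t) ∈ domS :=
    ⟨hθ.sin.mul hu.1, hu.2.1.mul_left, fun t ht => by simp [hu.2.2 t ht]⟩
  have i1 := integrableOn_schrodingerForm hW₁ hu
  have i2 := (integrableOn_sq_of_mem_domS hu).const_mul κ
  have i3 := (integrableOn_sq_of_mem_domS hc).const_mul ε
  have i4 := (integrableOn_sq_of_mem_domS hs).const_mul M
  have i12 : IntegrableOn (fun t => (deriv u t) ^ 2 + W₁ t * (u t) ^ 2 + κ * (u t) ^ 2)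
    (Set.Ioi 0) := i1.add i2
  have i123 : IntegrableOn (fun t => (deriv u t) ^ 2 + W₁ t * (u t) ^ 2 + κ * (u t) ^ 2
    + ε * (Real.cos (θ t) * u t) ^ 2) (Set.Ioi 0) := i12.add i3
  unfold schrodingerForm NS
  rw [← integral_const_mul, ← integral_const_mul, ← integral_const_mul,
    ← integral_add i1 i2, ← integral_add i12 i3, ← integral_sub i123 i4]
  refine setIntegral_mono_on (integrableOn_schrodingerForm hW₂ hc) (i123.sub i4)
    measurableSet_Ioi fun t ht => ?_
  have hdθ := (hθ.differentiable one_ne_zero t).hasDerivAt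
  have hdu := (hu.1.differentiable one_ne_zero t).hasDerivAt
  have hd : HasDerivAt (fun t => Real.cos (θ t) * u t)
    (-Real.sin (θ t) * deriv θ t * u t + Real.cos (θ t) * deriv u t) t := hdθ.cos.mul hdu
  rw [hd.deriv]
  have hsc := Real.sin_sq_add_cos_sq (θ t)
  have key1 : (-Real.sin (θ t) * deriv θ t * u t + Real.cos (θ t) * deriv u t) ^ 2
      ≤ (deriv u t) ^ 2 + κ * (u t) ^ 2 := by
    have h1 : (-Real.sin (θ t) * deriv θ t * u t + Real.cos (θ t) * deriv u t) ^ 2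
        + (Real.cos (θ t) * deriv θ t * u t + Real.sin (θ t) * deriv u t) ^ 2
        = (deriv u t) ^ 2 + (deriv θ t) ^ 2 * (u t) ^ 2 := by
      linear_combination ((deriv u t) ^ 2 + (deriv θ t) ^ 2 * (u t) ^ 2) * hsc
    have h2 := mul_le_mul_of_nonneg_right (hκ t) (sq_nonneg (u t))
    nlinarith [sq_nonneg (Real.cos (θ t) * deriv θ t * u t + Real.sin (θ t) * deriv u t)]
  have key2 : W₂ t * (Real.cos (θ t) * u t) ^ 2 ≤ (W₁ t + ε) * (Real.cos (θ t) * u t) ^ 2 := by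
    rcases le_total t δ with h | h
    · exact mul_le_mul_of_nonneg_right (hW t ht h) (sq_nonneg _)
    · simp [hθ1 t h]
  have key3 : M * (Real.sin (θ t) * u t) ^ 2 ≤ W₁ t * (Real.sin (θ t) * u t) ^ 2 := by
    rcases le_total t (δ / 2) with h | h
    · simp [hθ0 t h]
    · exact mul_le_mul_of_nonneg_right (hM t h) (sq_nonneg _)
  have key4 : W₁ t * (Real.cos (θ t) * u t) ^ 2 + W₁ t * (Real.sin (θ t) * u t) ^ 2
      = W₁ t * (u t) ^ 2 := by
    linear_combination (W₁ t * (u t) ^ 2) * hsc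
  linarith

theorem NS_cos_mul_add_NS_sin_mul {θ u : ℝ → ℝ} (hθ : ContDiff ℝ 1 θ) (hu : u ∈ domS) :
    NS (fun t => Real.cos (θ t) * u t) + NS (fun t => Real.sin (θ t) * u t) = NS u := by
  have hc : (fun t => Real.cos (θ t) * u t) ∈ domS :=
    ⟨hθ.cos.mul hu.1, hu.2.1.mul_left, fun t ht => by simp [hu.2.2 t ht]⟩
  have hs : (fun t => Real.sin (θ t) * u t) ∈ domS :=
    ⟨hθ.sin.mul hu.1, hu.2.1.mul_left, fun t ht => by simp [hu.2.2 t ht]⟩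
  unfold NS
  rw [← integral_add (integrableOn_sq_of_mem_domS hc) (integrableOn_sq_of_mem_domS hs)]
  congr 1
  ext t
  linear_combination (u t) ^ 2 * Real.sin_sq_add_cos_sq (θ t)

theorem add_mem_minmaxSet_of_cutoff {dom₁ dom₂ : Set (ℝ → ℝ)} {N₁ N₂ q₁ q₂ : (ℝ → ℝ) → ℝ}
    {W₁ W₂ θ : ℝ → ℝ} {δ κ ε M E : ℝ} {n : ℕ}
    (hW₁ : Continuous W₁) (hW₂ : Continuous W₂) (hθ : ContDiff ℝ 1 θ)
    (hθ0 : ∀ t ≤ δ / 2, θ t = 0) (hθ1 : ∀ t, δ ≤ t → θ t = Real.pi / 2)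
    (hκ : ∀ t, (deriv θ t) ^ 2 ≤ κ)
    (hM : ∀ t, δ / 2 ≤ t → M ≤ W₁ t) (hW : ∀ t, 0 < t → t ≤ δ → W₂ t ≤ W₁ t + ε)
    (hdom₁ : dom₁ ⊆ domS) (hdom₂ : dom₂ ⊆ domS)
    (hcut : ∀ u ∈ dom₁, (fun t => Real.cos (θ t) * u t) ∈ dom₂)
    (hN₁ : ∀ u ∈ dom₁, N₁ u = NS u) (hN₂ : ∀ u ∈ dom₂, N₂ u = NS u)
    (hq₁ : ∀ u ∈ dom₁, q₁ u = schrodingerForm W₁ u)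
    (hq₂ : ∀ u ∈ dom₂, q₂ u = schrodingerForm W₂ u)
    (hE : E ∈ minmaxSet dom₁ N₁ q₁ n) (hEM : E < M - κ) :
    E + (κ + ε) ∈ minmaxSet dom₂ N₂ q₂ n := by
  have main : ∀ u ∈ dom₁, q₁ u ≤ E * N₁ u →
      schrodingerForm W₂ (fun t => Real.cos (θ t) * u t)
        + (M - κ - E) * NS (fun t => Real.sin (θ t) * u t)
        ≤ (E + (κ + ε)) * NS (fun t => Real.cos (θ t) * u t) := by
    intro u hu hq
    rw [hq₁ u hu, hN₁ u hu] at hq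
    have h := schrodingerForm_cos_mul_le hW₁ hW₂ hθ hθ0 hθ1 hκ hM hW (hdom₁ hu)
    have h' := NS_cos_mul_add_NS_sin_mul hθ (hdom₁ hu)
    rw [← h'] at h hq
    linarith
  refine mem_minmaxSet_of_linearMap (LinearMap.mulLeft ℝ (fun t => Real.cos (θ t))) hcut
    (fun v hv h => eq_zero_of_NS_eq_zero (hdom₂ hv) (hN₂ v hv ▸ h)) (fun u hu hq => ?_)
    (fun u hu hq h0 => ?_) hE
  · change q₂ (fun t => Real.cos (θ t) * u t) ≤ _ * N₂ (fun t => Real.cos (θ t) * u t)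
    rw [hq₂ _ (hcut u hu), hN₂ _ (hcut u hu)]
    have := mul_nonneg (sub_pos.2 hEM).le (NS_nonneg (fun t => Real.sin (θ t) * u t))
    linarith [main u hu hq]
  · change (fun t => Real.cos (θ t) * u t) = 0 at h0
    have h := main u hu hq
    have h' := NS_cos_mul_add_NS_sin_mul hθ (hdom₁ hu)
    rw [h0] at h h'
    have h1 : schrodingerForm W₂ 0 = 0 := by simp [schrodingerForm]
    have h2 : NS 0 = 0 := by simp [NS]
    rw [h1, h2] at h
    rw [h2] at h'
    rw [hN₁ u hu, ← h', zero_add]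
    refine le_antisymm ?_ (NS_nonneg _)
    by_contra! hpos
    linarith [mul_pos (sub_pos.2 hEM) hpos]

theorem exists_cutoff_angle : ∃ K : ℝ, 0 < K ∧ ∀ δ : ℝ, 0 < δ → ∃ θ : ℝ → ℝ, ContDiff ℝ 1 θ ∧
    (∀ t ≤ δ / 2, θ t = 0) ∧ (∀ t, δ ≤ t → θ t = Real.pi / 2) ∧
    ∀ t, (deriv θ t) ^ 2 ≤ K * (δ ^ 2)⁻¹ := by
  have hdiff : ContDiff ℝ 1 Real.smoothTransition := Real.smoothTransition.contDiff
  obtain ⟨B, hB⟩ : ∃ B, ∀ x, ‖deriv Real.smoothTransition x‖ ≤ B := by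
    refine HasCompactSupport.exists_bound_of_continuous ?_ (hdiff.continuous_deriv le_rfl)
    refine HasCompactSupport.intro (isCompact_Icc (a := (0 : ℝ)) (b := 1)) fun x hx => ?_
    rcases lt_or_ge x 0 with h | h
    · have : Real.smoothTransition =ᶠ[𝓝 x] fun _ => (0 : ℝ) := by
        filter_upwards [Iio_mem_nhds h] with y hy
        exact Real.smoothTransition.zero_of_nonpos (le_of_lt hy)
      rw [this.deriv_eq, deriv_const]
    · have h1 : 1 < x := by
        by_contra! h1
        exact hx ⟨h, h1⟩
      have : Real.smoothTransition =ᶠ[𝓝 x] fun _ => (1 : ℝ) := by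
        filter_upwards [Ioi_mem_nhds h1] with y hy
        exact Real.smoothTransition.one_of_one_le (le_of_lt hy)
      rw [this.deriv_eq, deriv_const]
  refine ⟨(Real.pi * B) ^ 2 + 1, by positivity, fun δ hδ =>
    ⟨fun t => Real.pi / 2 * Real.smoothTransition (2 / δ * t - 1), ?_, ?_, ?_, ?_⟩⟩
  · exact contDiff_const.mul (hdiff.comp ((contDiff_const.mul contDiff_id).sub contDiff_const))
  · intro t ht
    beta_reduce
    rw [Real.smoothTransition.zero_of_nonpos, mul_zero]
    have := mul_le_mul_of_nonneg_left ht (by positivity : 0 ≤ 2 / δ)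
    have h2 : 2 / δ * (δ / 2) = 1 := by field_simp
    linarith
  · intro t ht
    beta_reduce
    rw [Real.smoothTransition.one_of_one_le, mul_one]
    have := mul_le_mul_of_nonneg_left ht (by positivity : 0 ≤ 2 / δ)
    have h2 : 2 / δ * δ = 2 := by field_simp
    linarith
  · intro t
    have hd : HasDerivAt (fun t => Real.pi / 2 * Real.smoothTransition (2 / δ * t - 1))
        (Real.pi / 2 * (deriv Real.smoothTransition (2 / δ * t - 1) * (2 / δ * 1))) t :=
      (((hdiff.differentiable one_ne_zero _).hasDerivAt).comp t
        (((hasDerivAt_id t).const_mul (2 / δ)).sub_const 1)).const_mul _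
    rw [hd.deriv]
    have hb := hB (2 / δ * t - 1)
    have hsq : (deriv Real.smoothTransition (2 / δ * t - 1)) ^ 2 ≤ B ^ 2 :=
      sq_le_sq' (neg_le_of_abs_le hb) (le_of_abs_le hb)
    have e : (Real.pi / 2 * (deriv Real.smoothTransition (2 / δ * t - 1) * (2 / δ * 1))) ^ 2
        = (Real.pi ^ 2 * (δ ^ 2)⁻¹) * (deriv Real.smoothTransition (2 / δ * t - 1)) ^ 2 := by
      field_simp
    rw [e]
    have h1 := mul_le_mul_of_nonneg_left hsq (by positivity : 0 ≤ Real.pi ^ 2 * (δ ^ 2)⁻¹)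
    have h2 : 0 < (δ ^ 2)⁻¹ := by positivity
    linarith

/-- A family of translated bumps with pairwise disjoint supports in `(0,∞)`. -/
def bumpFamily (i : ℕ) (t : ℝ) : ℝ :=
  Real.smoothTransition (t - i) * Real.smoothTransition (i + 1 - t)

theorem bumpFamily_eq_zero {i : ℕ} {t : ℝ} (ht : t ∉ Set.Ioo (i : ℝ) (i + 1)) :
    bumpFamily i t = 0 := by
  rw [Set.mem_Ioo, not_and_or, not_lt, not_lt] at ht
  rcases ht with h | h
  · simp [bumpFamily, Real.smoothTransition.zero_of_nonpos (sub_nonpos.2 h)]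
  · simp [bumpFamily, Real.smoothTransition.zero_of_nonpos (sub_nonpos.2 h)]

theorem contDiff_bumpFamily (i : ℕ) : ContDiff ℝ 1 (bumpFamily i) :=
  (Real.smoothTransition.contDiff.comp (contDiff_id.sub contDiff_const)).mul
    (Real.smoothTransition.contDiff.comp (contDiff_const.sub contDiff_id))

theorem bumpFamily_mem_domS (i : ℕ) : bumpFamily i ∈ domS := by
  refine ⟨contDiff_bumpFamily i, HasCompactSupport.intro
    (isCompact_Icc (a := (i : ℝ)) (b := i + 1)) fun t ht =>
    bumpFamily_eq_zero fun h => ht (Ioo_subset_Icc_self h), fun t ht =>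
    bumpFamily_eq_zero fun h => ?_⟩
  have : (0 : ℝ) ≤ i := i.cast_nonneg
  linarith [h.1]

theorem bumpFamily_midpoint_pos (i : ℕ) : 0 < bumpFamily i (i + 1 / 2) :=
  mul_pos (Real.smoothTransition.pos_of_pos (by linarith))
    (Real.smoothTransition.pos_of_pos (by linarith))

theorem disjoint_Ioo_nat {i j : ℕ} {t : ℝ} (hi : t ∈ Set.Ioo (i : ℝ) (i + 1))
    (hj : t ∈ Set.Ioo (j : ℝ) (j + 1)) : i = j := by
  have h1 : (i : ℝ) < j + 1 := hi.1.trans hj.2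
  have h2 : (j : ℝ) < i + 1 := hj.1.trans hi.2
  norm_cast at h1 h2
  omega

theorem bumpFamily_mul_of_ne {i j : ℕ} (hij : i ≠ j) (t : ℝ) :
    bumpFamily i t * bumpFamily j t = 0 := by
  by_cases hi : t ∈ Set.Ioo (i : ℝ) (i + 1)
  · rw [bumpFamily_eq_zero fun hj => hij (disjoint_Ioo_nat hi hj), mul_zero]
  · rw [bumpFamily_eq_zero hi, zero_mul]

theorem deriv_bumpFamily_eq_zero {i : ℕ} {t : ℝ} (ht : t ∉ Set.Ioo (i : ℝ) (i + 1)) :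
    deriv (bumpFamily i) t = 0 := by
  refine IsLocalMin.deriv_eq_zero (Filter.Eventually.of_forall fun s => ?_)
  rw [bumpFamily_eq_zero ht]
  exact mul_nonneg (Real.smoothTransition.nonneg _) (Real.smoothTransition.nonneg _)

theorem deriv_bumpFamily_mul_of_ne {i j : ℕ} (hij : i ≠ j) (t : ℝ) :
    deriv (bumpFamily i) t * deriv (bumpFamily j) t = 0 := by
  by_cases hi : t ∈ Set.Ioo (i : ℝ) (i + 1)
  · rw [deriv_bumpFamily_eq_zero fun hj => hij (disjoint_Ioo_nat hi hj), mul_zero]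
  · rw [deriv_bumpFamily_eq_zero hi, zero_mul]

theorem sq_sum_eq_sum_sq_of_mul_eq_zero {ι : Type*} (s : Finset ι) (c f : ι → ℝ)
    (h : ∀ i j, i ≠ j → f i * f j = 0) :
    (∑ i ∈ s, c i * f i) ^ 2 = ∑ i ∈ s, c i ^ 2 * f i ^ 2 := by
  rw [sq, Finset.sum_mul_sum]
  refine Finset.sum_congr rfl fun i hi => ?_
  rw [Finset.sum_eq_single i (fun j _ hj => ?_) fun h => absurd hi h]
  · ring
  · linear_combination c i * c j * h i j hj.symm

theorem nonempty_minmaxSet_schrodingerForm {W : ℝ → ℝ} (hW : Continuous W)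
    (hW0 : ∀ t, 0 < t → 0 ≤ W t) (n : ℕ) :
    (minmaxSet domS NS (schrodingerForm W) n).Nonempty := by
  let T : (Fin n → ℝ) →ₗ[ℝ] (ℝ → ℝ) := Fintype.linearCombination ℝ fun i : Fin n => bumpFamily i
  have hT : ∀ c, T c = fun t => ∑ i, c i * bumpFamily i t := fun c => by
    ext t
    simp [T, Fintype.linearCombination_apply]
  have hdom : ∀ c, T c ∈ domS := fun c => by
    rw [hT]
    refine ⟨ContDiff.sum fun i _ => contDiff_const.mul (contDiff_bumpFamily i), ?_, fun t ht =>
      Finset.sum_eq_zero fun i _ => by rw [(bumpFamily_mem_domS i).2.2 t ht, mul_zero]⟩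
    refine HasCompactSupport.intro (isCompact_Icc (a := (0 : ℝ)) (b := n)) fun t ht =>
      Finset.sum_eq_zero fun i _ => ?_
    rw [bumpFamily_eq_zero, mul_zero]
    intro h
    have h1 : (0 : ℝ) ≤ (i : ℕ) := Nat.cast_nonneg _
    have h2 : ((i : ℕ) : ℝ) + 1 ≤ n := by exact_mod_cast i.2
    exact ht ⟨h1.trans h.1.le, h.2.le.trans h2⟩
  have hne : ∀ i : ℕ, NS (bumpFamily i) ≠ 0 := fun i h => by
    have := congrFun (eq_zero_of_NS_eq_zero (bumpFamily_mem_domS i) h) (i + 1 / 2)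
    exact (bumpFamily_midpoint_pos i).ne' this
  have hinj : Function.Injective T := by
    rw [← LinearMap.ker_eq_bot, LinearMap.ker_eq_bot']
    intro c hc
    ext i
    have h := congrFun ((hT c).symm.trans hc) ((i : ℕ) + 1 / 2)
    beta_reduce at h
    rw [Finset.sum_eq_single i (fun j _ hj => ?_) (by simp)] at h
    · exact (mul_eq_zero.1 h).resolve_right (bumpFamily_midpoint_pos i).ne'
    · rw [bumpFamily_eq_zero fun hm => hj (Fin.ext (disjoint_Ioo_nat hm ⟨?_, ?_⟩)), mul_zero] <;>
        linarith
  have hsq : ∀ c t, (T c t) ^ 2 = ∑ i, c i ^ 2 * bumpFamily i t ^ 2 := fun c t => by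
    rw [hT]
    exact sq_sum_eq_sum_sq_of_mul_eq_zero _ c (fun i : Fin n => bumpFamily i t)
      fun i j hij => bumpFamily_mul_of_ne (fun h => hij (Fin.ext h)) t
  have hdsq : ∀ c t, (deriv (T c) t) ^ 2 = ∑ i, c i ^ 2 * deriv (bumpFamily i) t ^ 2 :=
      fun c t => by
    have hd : HasDerivAt (fun t => ∑ i : Fin n, c i * bumpFamily i t)
        (∑ i : Fin n, c i * deriv (bumpFamily i) t) t :=
      HasDerivAt.fun_sum fun i _ =>
        (((contDiff_bumpFamily i).differentiable one_ne_zero t).hasDerivAt).const_mul _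
    rw [hT, hd.deriv]
    exact sq_sum_eq_sum_sq_of_mul_eq_zero _ c (fun i : Fin n => deriv (bumpFamily i) t)
      fun i j hij => deriv_bumpFamily_mul_of_ne (fun h => hij (Fin.ext h)) t
  have hNT : ∀ c, NS (T c) = ∑ i, c i ^ 2 * NS (bumpFamily i) := fun c => by
    unfold NS
    simp only [hsq]
    rw [integral_finsetSum _ fun (i : Fin n) _ =>
      (integrableOn_sq_of_mem_domS (bumpFamily_mem_domS i)).const_mul _]
    simp only [integral_const_mul]
  have hqT : ∀ c, schrodingerForm W (T c) = ∑ i, c i ^ 2 * schrodingerForm W (bumpFamily i) :=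
      fun c => by
    unfold schrodingerForm
    simp only [← integral_const_mul]
    rw [← integral_finsetSum _ fun (i : Fin n) _ =>
      (integrableOn_schrodingerForm hW (bumpFamily_mem_domS i)).const_mul _]
    congr 1
    ext t
    rw [hsq, hdsq, Finset.mul_sum, ← Finset.sum_add_distrib]
    exact Finset.sum_congr rfl fun i _ => by ring
  refine ⟨∑ i : Fin n, schrodingerForm W (bumpFamily i) / NS (bumpFamily i), LinearMap.range T,
    ?_, ?_, ?_, ?_⟩
  · rintro _ ⟨c, rfl⟩
    exact hdom c
  · rw [LinearMap.finrank_range_of_inj hinj, Module.finrank_fin_fun]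
  · rintro _ ⟨c, rfl⟩
    exact eq_zero_of_NS_eq_zero (hdom c)
  · rintro _ ⟨c, rfl⟩
    rw [hqT, hNT, Finset.mul_sum]
    refine Finset.sum_le_sum fun i _ => ?_
    have hle : schrodingerForm W (bumpFamily i) / NS (bumpFamily i)
        ≤ ∑ j : Fin n, schrodingerForm W (bumpFamily j) / NS (bumpFamily j) :=
      Finset.single_le_sum (f := fun j : Fin n =>
        schrodingerForm W (bumpFamily j) / NS (bumpFamily j))
        (fun j _ => div_nonneg (schrodingerForm_nonneg hW0 _) (NS_nonneg _)) (Finset.mem_univ i)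
    rw [div_le_iff₀ ((NS_nonneg _).lt_of_ne (hne i).symm)] at hle
    have := mul_le_mul_of_nonneg_left hle (sq_nonneg (c i))
    linarith

theorem mul_mem_minmaxSet_qS {m n : ℕ} {β l E : ℝ} (hl : 0 < l)
    (hE : E ∈ minmaxSet domS NS (qS m β) n) :
    l ^ 2 * E ∈ minmaxSet domS NS (qS m (β * l ^ (m + 2))) n := by
  have hN : ∀ u : ℝ → ℝ, NS (fun t => u (l * t)) = l⁻¹ * NS u := fun u => by
    have := integral_comp_mul_left_Ioi (fun s => (u s) ^ 2) 0 hl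
    simpa [NS] using this
  refine mem_minmaxSet_of_linearMap (LinearMap.funLeft ℝ ℝ (fun t : ℝ => l * t)) ?_
    (fun v hv => eq_zero_of_NS_eq_zero hv) ?_ ?_ hE
  · intro u hu
    refine ⟨hu.1.comp (contDiff_const.mul contDiff_id), ?_, fun t ht => ?_⟩
    · exact hu.2.1.comp_homeomorph (Homeomorph.mulLeft₀ l hl.ne')
    · exact hu.2.2 _ (mul_nonpos_of_nonneg_of_nonpos hl.le ht)
  · intro u hu hq
    change qS m (β * l ^ (m + 2)) (fun t => u (l * t)) ≤ _ * NS (fun t => u (l * t))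
    have hq' : qS m (β * l ^ (m + 2)) (fun t => u (l * t)) = l * qS m β u := by
      have := integral_comp_mul_left_Ioi
        (fun s => l ^ 2 * ((deriv u s) ^ 2 + β * s ^ m * (u s) ^ 2)) 0 hl
      simp only [mul_zero, smul_eq_mul, integral_const_mul] at this
      have e : l⁻¹ * (l ^ 2 * qS m β u) = l * qS m β u := by field_simp
      rw [← e]
      unfold qS
      rw [← this, ← integral_const_mul]
      congr 1
      ext t
      have hd : HasDerivAt (fun t => u (l * t)) (deriv u (l * t) * (l * 1)) t :=
        ((hu.1.differentiable one_ne_zero _).hasDerivAt).comp t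
          ((hasDerivAt_id t).const_mul l)
      rw [hd.deriv]
      ring
    rw [hq', hN]
    have e : l ^ 2 * E * (l⁻¹ * NS u) = l * (E * NS u) := by field_simp
    rw [e]
    exact mul_le_mul_of_nonneg_left hq hl.le
  · intro u hu _ h0
    change (fun t => u (l * t)) = 0 at h0
    have h := hN u
    rw [h0] at h
    have h2 : NS 0 = 0 := by simp [NS]
    rw [h2] at h
    rcases mul_eq_zero.1 h.symm with h | h
    · exact absurd h (inv_pos.2 hl).ne'
    · exact h

theorem bddBelow_minmaxSet_qS {m n : ℕ} (hn : 1 ≤ n) {β : ℝ} (hβ : 0 ≤ β) :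
    BddBelow (minmaxSet domS NS (qS m β) n) :=
  ⟨0, fun _ hE => nonneg_of_mem_minmaxSet hn NS_nonneg
    (fun u _ => schrodingerForm_nonneg (W := fun t => β * t ^ m)
      (fun t ht => by positivity) u) hE⟩

/-- Scaling: `E_n(S_{m,λ^{m+2}}) = λ² E_n(S_{m,1})`. -/
theorem ES_pow {m n : ℕ} (hn : 1 ≤ n) (hne : (minmaxSet domS NS (qS m 1) n).Nonempty)
    {l : ℝ} (hl : 0 < l) : ES m (l ^ (m + 2)) n = l ^ 2 * ES m 1 n := by
  change sInf (minmaxSet domS NS (qS m (l ^ (m + 2))) n)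
    = l ^ 2 * sInf (minmaxSet domS NS (qS m 1) n)
  have h1 : ∀ E ∈ minmaxSet domS NS (qS m 1) n,
      l ^ 2 * E ∈ minmaxSet domS NS (qS m (l ^ (m + 2))) n := fun E hE => by
    simpa using mul_mem_minmaxSet_qS hl hE
  have h2 : ∀ E ∈ minmaxSet domS NS (qS m (l ^ (m + 2))) n,
      l⁻¹ ^ 2 * E ∈ minmaxSet domS NS (qS m 1) n := fun E hE => by
    have := mul_mem_minmaxSet_qS (inv_pos.2 hl) hE
    rwa [← mul_pow, mul_inv_cancel₀ hl.ne', one_pow] at this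
  have hl2 : 0 < l ^ 2 := by positivity
  refine le_antisymm ?_ ?_
  · rw [← div_le_iff₀' hl2]
    refine le_csInf hne fun E hE => ?_
    rw [div_le_iff₀' hl2]
    exact csInf_le (bddBelow_minmaxSet_qS hn (by positivity)) (h1 E hE)
  · obtain ⟨E₀, hE₀⟩ := hne
    refine le_csInf ⟨_, h1 E₀ hE₀⟩ fun E hE => ?_
    have := csInf_le (bddBelow_minmaxSet_qS hn zero_le_one) (h2 E hE)
    calc l ^ 2 * sInf (minmaxSet domS NS (qS m 1) n) ≤ l ^ 2 * (l⁻¹ ^ 2 * E) := by gcongr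
      _ = E := by field_simp

theorem domDir_subset_domS (a : ℝ) : domDir a ⊆ domS := by
  rintro f ⟨hf, h0⟩
  refine ⟨hf, HasCompactSupport.intro (isCompact_Icc (a := (0 : ℝ)) (b := a)) fun t ht =>
    h0 t fun h => ht (Ioo_subset_Icc_self h), fun t ht => h0 t fun h => not_lt.2 ht h.1⟩

theorem integral_Ioi_eq_intervalIntegral {a : ℝ} (ha : 0 < a) {F G : ℝ → ℝ}
    (hFG : ∀ t ∈ Set.Ioc 0 a, F t = G t) (h0 : ∀ t, a < t → G t = 0) :
    ∫ t in (0 : ℝ)..a, F t = ∫ t in Set.Ioi (0 : ℝ), G t := by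
  rw [intervalIntegral.integral_of_le ha.le, setIntegral_congr_fun measurableSet_Ioc hFG]
  refine (setIntegral_eq_of_subset_of_forall_sdiff_eq_zero measurableSet_Ioi
    Ioc_subset_Ioi_self fun t ht => h0 t ?_).symm
  by_contra! h
  exact ht.2 ⟨ht.1, h⟩

theorem NDir_eq_NS {a : ℝ} (ha : 0 < a) {f : ℝ → ℝ} (hf : f ∈ domDir a) : NDir a f = NS f :=
  integral_Ioi_eq_intervalIntegral ha (fun _ _ => rfl) fun t ht => by
    simp [hf.2 t fun h => h.2.not_gt ht]

theorem qDir_eq_schrodingerForm {a : ℝ} (ha : 0 < a) {f U W : ℝ → ℝ} {α : ℝ}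
    (hW : ∀ t ∈ Set.Ioc 0 a, W t = α * U t) (hf : f ∈ domDir a) :
    qDir a U α f = schrodingerForm W f := by
  refine integral_Ioi_eq_intervalIntegral ha (fun t ht => by rw [hW t ht]) fun t ht => ?_
  have : f =ᶠ[𝓝 t] fun _ => (0 : ℝ) := by
    filter_upwards [Ioi_mem_nhds ht] with y hy
    exact hf.2 y fun h => h.2.not_gt hy
  rw [this.deriv_eq, deriv_const, this.eq_of_nhds]
  simp

theorem exists_abs_sub_pow_le_of_iteratedDerivWithin {a : ℝ} (ha : 0 < a) {m : ℕ}
    {U : ℝ → ℝ} (hU : ContDiffOn ℝ (m + 1 : ℕ) U (Set.Icc 0 a)) (hU0 : U 0 = 0)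
    (hUj : ∀ j : ℕ, 1 ≤ j → j < m → iteratedDerivWithin j U (Set.Icc 0 a) 0 = 0) :
    ∃ K : ℝ, 0 < K ∧ ∀ t ∈ Set.Icc 0 a,
      |U t - iteratedDerivWithin m U (Set.Icc 0 a) 0 / (Nat.factorial m) * t ^ m|
        ≤ K * t ^ (m + 1) := by
  obtain ⟨K, hK⟩ := exists_taylor_mean_remainder_bound (n := m) ha.le
    (by exact_mod_cast hU)
  refine ⟨max K 1, lt_max_of_lt_right one_pos, fun t ht => ?_⟩
  have h := hK t ht
  rw [taylor_within_apply, Finset.sum_range_succ, Finset.sum_eq_zero fun k hk => ?_] at h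
  · rw [sub_zero, zero_add, Real.norm_eq_abs, smul_eq_mul] at h
    calc _ = |U t - ((m.factorial : ℝ)⁻¹ * t ^ m) * iteratedDerivWithin m U (Set.Icc 0 a) 0| := by
          ring_nf
      _ ≤ K * t ^ (m + 1) := h
      _ ≤ max K 1 * t ^ (m + 1) :=
          mul_le_mul_of_nonneg_right (le_max_left _ _) (pow_nonneg ht.1 _)
  · rcases Nat.eq_zero_or_pos k with rfl | hk0
    · simp [hU0]
    · rw [hUj k hk0 (Finset.mem_range.1 hk), smul_zero]

theorem exists_mul_pow_le_of_pos {a c K : ℝ} (ha : 0 < a) (hc : 0 < c) (hK : 0 < K) {m : ℕ}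
    {U : ℝ → ℝ} (hU : ContinuousOn U (Set.Icc 0 a)) (hpos : ∀ t ∈ Set.Ioc (0:ℝ) a, 0 < U t)
    (hT : ∀ t ∈ Set.Icc 0 a, |U t - c * t ^ m| ≤ K * t ^ (m + 1)) :
    ∃ b : ℝ, 0 < b ∧ b ≤ c ∧ ∀ t ∈ Set.Icc 0 a, b * t ^ m ≤ U t := by
  let r := min a (c / (2 * K))
  have hr : 0 < r := lt_min ha (by positivity)
  obtain ⟨s, hs, hmin⟩ := (isCompact_Icc (a := r) (b := a)).exists_isMinOn
    ⟨a, min_le_left _ _, le_rfl⟩ (hU.mono (Icc_subset_Icc_left hr.le))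
  have hUs : 0 < U s := hpos s ⟨hr.trans_le hs.1, hs.2⟩
  refine ⟨min (c / 2) (U s / a ^ m), lt_min (by positivity) (by positivity),
    (min_le_left _ _).trans (by linarith), fun t ht => ?_⟩
  have htm : 0 ≤ t ^ m := pow_nonneg ht.1 m
  rcases le_total t r with h | h
  · have h1 := (abs_le.1 (hT t ht)).1
    have h2 : K * t ≤ c / 2 := by
      have := mul_le_mul_of_nonneg_left (h.trans (min_le_right _ _)) hK.le
      have e : K * (c / (2 * K)) = c / 2 := by field_simp
      linarith
    have h3 := mul_le_mul_of_nonneg_right h2 htm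
    have h4 := mul_le_mul_of_nonneg_right (min_le_left (c / 2) (U s / a ^ m)) htm
    rw [pow_succ] at h1
    linarith
  · calc _ ≤ U s / a ^ m * t ^ m := mul_le_mul_of_nonneg_right (min_le_right _ _) htm
      _ ≤ U s / a ^ m * a ^ m := by gcongr; exacts [ht.1, ht.2]
      _ = U s := by field_simp
      _ ≤ U t := hmin ⟨h, ht.2⟩

theorem abs_EDU_sub_ES_le {a : ℝ} {m n : ℕ} (hn : 1 ≤ n) {U θ : ℝ → ℝ}
    {b c α δ κ ε : ℝ} (hU : ContinuousOn U (Set.Icc 0 a)) (hb : 0 < b) (hbc : b ≤ c)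
    (hα : 0 < α) (hδ : 0 < δ) (hδa : δ ≤ a) (hκ0 : 0 ≤ κ) (hε : 0 ≤ ε)
    (hUb : ∀ t ∈ Set.Icc 0 a, b * t ^ m ≤ U t)
    (hUε : ∀ t ∈ Set.Icc 0 δ, |α * U t - c * α * t ^ m| ≤ ε)
    (hθ : ContDiff ℝ 1 θ)
    (hθ0 : ∀ t ≤ δ / 2, θ t = 0) (hθ1 : ∀ t, δ ≤ t → θ t = Real.pi / 2)
    (hκ : ∀ t, (deriv θ t) ^ 2 ≤ κ)
    (hlt : ES m (c * α) n + 2 * κ + ε < α * (b * (δ / 2) ^ m)) :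
    |EDU a U α n - ES m (c * α) n| ≤ κ + ε := by
  have ha : 0 < a := hδ.trans_le hδa
  have hc : 0 ≤ c := hb.le.trans hbc
  have hcα : 0 < c * α := mul_pos (hb.trans_le hbc) hα
  let W : ℝ → ℝ := fun t => α * Set.IccExtend ha.le (Set.domRestrict (Set.Icc 0 a) U) t
  let W' : ℝ → ℝ := fun t => c * α * t ^ m
  have hWeq : ∀ t ∈ Set.Icc 0 a, W t = α * U t := fun t ht => by
    simp only [W]
    rw [Set.IccExtend_of_mem _ _ ht, Set.domRestrict_apply]
  have hW : Continuous W :=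
    continuous_const.mul (continuousOn_iff_continuous_domRestrict.1 hU).Icc_extend'
  have hW' : Continuous W' := continuous_const.mul (continuous_pow m)
  have hM' : ∀ t, δ / 2 ≤ t → α * (b * (δ / 2) ^ m) ≤ W' t := fun t ht => by
    calc α * (b * (δ / 2) ^ m) ≤ α * (c * t ^ m) := by gcongr
      _ = W' t := by simp only [W']; ring
  have hM : ∀ t, δ / 2 ≤ t → α * (b * (δ / 2) ^ m) ≤ W t := fun t ht => by
    have hp := (Set.projIcc 0 a ha.le t).2
    have hle : δ / 2 ≤ Set.projIcc 0 a ha.le t := by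
      rw [Set.coe_projIcc]
      exact le_max_of_le_right (le_min (by linarith) ht)
    calc α * (b * (δ / 2) ^ m) ≤ α * (b * (Set.projIcc 0 a ha.le t : ℝ) ^ m) := by gcongr
      _ ≤ α * U (Set.projIcc 0 a ha.le t) := by gcongr; exact hUb _ hp
  have hW0 : ∀ t, 0 < t → 0 ≤ W t := fun t ht => by
    have hp := (Set.projIcc 0 a ha.le t).2
    exact mul_nonneg hα.le ((mul_nonneg hb.le (pow_nonneg hp.1 m)).trans (hUb _ hp))
  have hN : ∀ u ∈ domDir a, NDir a u = NS u := fun u hu => NDir_eq_NS ha hu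
  have hq : ∀ u ∈ domDir a, qDir a U α u = schrodingerForm W u := fun u hu =>
    qDir_eq_schrodingerForm ha (fun t ht => hWeq t (Ioc_subset_Icc_self ht)) hu
  have hup := csInf_le_csInf_add (S := minmaxSet domS NS (qS m (c * α)) n)
    (T := minmaxSet (domDir a) (NDir a) (qDir a U α) n) (M := α * (b * (δ / 2) ^ m) - κ)
    (d := κ + ε) (nonempty_minmaxSet_schrodingerForm hW' (fun t ht => by positivity) n)
    ⟨0, fun E hE => nonneg_of_mem_minmaxSet hn
      (fun u => intervalIntegral.integral_nonneg ha.le fun _ _ => sq_nonneg _)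
      (fun u hu => (hq u hu).symm ▸ schrodingerForm_nonneg hW0 u) hE⟩
    (by change ES m (c * α) n < _; linarith)
    (fun E hE hEM => add_mem_minmaxSet_of_cutoff hW' hW hθ hθ0 hθ1 hκ hM'
      (fun t ht htδ => by
        rw [hWeq t ⟨ht.le, htδ.trans hδa⟩]
        linarith [(abs_le.1 (hUε t ⟨ht.le, htδ⟩)).2]) subset_rfl (domDir_subset_domS a)
      (fun u hu => ⟨hθ.cos.mul hu.1, fun t ht => by
        rcases le_or_gt t 0 with h | h
        · simp [hu.2.2 t h]
        · have : a ≤ t := by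
            by_contra! h'
            exact ht ⟨h, h'⟩
          simp [hθ1 t (hδa.trans this)]⟩)
      (fun _ _ => rfl) hN (fun _ _ => rfl) hq hE hEM)
  change _ ∧ EDU a U α n ≤ ES m (c * α) n + (κ + ε) at hup
  have hlow := csInf_le_csInf_add (S := minmaxSet (domDir a) (NDir a) (qDir a U α) n)
    (T := minmaxSet domS NS (qS m (c * α)) n) (M := α * (b * (δ / 2) ^ m) - κ)
    (d := κ + ε) hup.1 (bddBelow_minmaxSet_qS hn hcα.le)
    (by change EDU a U α n < _; linarith [hup.2])
    (fun E hE hEM => add_mem_minmaxSet_of_cutoff hW hW' hθ hθ0 hθ1 hκ hM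
      (fun t ht htδ => by
        rw [hWeq t ⟨ht.le, htδ.trans hδa⟩]
        linarith [(abs_le.1 (hUε t ⟨ht.le, htδ⟩)).1]) (domDir_subset_domS a) subset_rfl
      (fun u hu => ⟨hθ.cos.mul hu.1, (domDir_subset_domS a hu).2.1.mul_left,
        fun t ht => by simp [(domDir_subset_domS a hu).2.2 t ht]⟩)
      hN (fun _ _ => rfl) hq (fun _ _ => rfl) hE hEM)
  change _ ∧ ES m (c * α) n ≤ EDU a U α n + (κ + ε) at hlow
  rw [abs_le]
  constructor <;> linarith [hup.2, hlow.2]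

theorem eventually_const_mul_rpow_lt {A B p q : ℝ} (hB : 0 < B) (hpq : p < q) :
    ∀ᶠ α : ℝ in atTop, A * α ^ p < B * α ^ q := by
  have h := (tendsto_rpow_atTop (sub_pos.2 hpq)).eventually_gt_atTop (A / B)
  filter_upwards [h, eventually_gt_atTop 0] with α h1 h0
  rw [div_lt_iff₀ hB] at h1
  calc A * α ^ p < (α ^ (q - p) * B) * α ^ p :=
        mul_lt_mul_of_pos_right h1 (Real.rpow_pos_of_pos h0 p)
    _ = B * (α ^ (q - p) * α ^ p) := by ring
    _ = B * α ^ q := by rw [← Real.rpow_add h0, sub_add_cancel]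

end

/-- Lemma 5.4 (semiclassical asymptotics for a potential minimal at an endpoint):
`E_n(D + αU) = (U^{(m)}(0)/m!)^{2/(2+m)} E_n(S_{m,1}) α^{2/(2+m)} + O(α^{2/(3+m)})`. -/
theorem semiclassical_endpoint_minimum (a : ℝ) (ha : 0 < a) (m : ℕ) (hm : 1 ≤ m)
    (U : ℝ → ℝ) (hU : ContDiffOn ℝ (m + 1 : ℕ) U (Set.Icc 0 a)) (hU0 : U 0 = 0)
    (hpos : ∀ t ∈ Set.Ioc (0:ℝ) a, 0 < U t)
    (hUm : 0 < iteratedDerivWithin m U (Set.Icc 0 a) 0)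
    (hUj : ∀ j : ℕ, 1 ≤ j → j < m → iteratedDerivWithin j U (Set.Icc 0 a) 0 = 0)
    (n : ℕ) (hn : 1 ≤ n) :
    ∃ C α₀ : ℝ, 0 < C ∧ 0 < α₀ ∧ ∀ α : ℝ, α₀ < α →
      |EDU a U α n
          - (iteratedDerivWithin m U (Set.Icc 0 a) 0 / (Nat.factorial m)) ^ ((2:ℝ) / (2 + m))
            * ES m 1 n * α ^ ((2:ℝ) / (2 + m))|
        ≤ C * α ^ ((2:ℝ) / (3 + m)) := by
  obtain ⟨K, hK, hT⟩ := exists_abs_sub_pow_le_of_iteratedDerivWithin ha hU hU0 hUj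
  set c : ℝ := iteratedDerivWithin m U (Set.Icc 0 a) 0 / (Nat.factorial m) with hc_def
  have hc : 0 < c := by positivity
  obtain ⟨b, hb, hbc, hUb⟩ := exists_mul_pow_le_of_pos ha hc hK hU.continuousOn hpos hT
  obtain ⟨L, hL, hcut⟩ := exists_cutoff_angle
  have hm0 : (0 : ℝ) < m := by exact_mod_cast hm
  have hscale : ∀ α : ℝ, 0 < α → ES m (c * α) n
      = c ^ ((2:ℝ) / (2 + m)) * ES m 1 n * α ^ ((2:ℝ) / (2 + m)) := by
    intro α hα
    have hcα : 0 < c * α := mul_pos hc hα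
    have h := ES_pow hn (nonempty_minmaxSet_schrodingerForm (W := fun t => 1 * t ^ m)
      (by fun_prop) (fun t ht => by positivity) n)
      (Real.rpow_pos_of_pos hcα ((1:ℝ) / (2 + m)))
    rw [← Real.rpow_mul_natCast hcα.le, ← Real.rpow_mul_natCast hcα.le] at h
    have e1 : (1:ℝ) / (2 + m) * ((m + 2 : ℕ) : ℝ) = 1 := by
      push_cast
      field_simp
      ring
    have e2 : (1:ℝ) / (2 + m) * ((2 : ℕ) : ℝ) = 2 / (2 + m) := by
      push_cast
      ring
    rw [e1, e2, Real.rpow_one, Real.mul_rpow hc.le hα.le] at h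
    rw [h]
    ring
  have hp1 : (2:ℝ) / (2 + m) < 3 / (3 + m) := by
    rw [div_lt_div_iff₀ (by positivity) (by positivity)]
    linarith
  have hp2 : (2:ℝ) / (3 + m) < 3 / (3 + m) := by
    gcongr
    norm_num
  have hB : 0 < b / 2 ^ m := by positivity
  have hev1 := eventually_const_mul_rpow_lt (A := c ^ ((2:ℝ) / (2 + m)) * ES m 1 n)
    (half_pos hB) hp1
  have hev2 := eventually_const_mul_rpow_lt (A := 2 * L + K) (half_pos hB) hp2
  have hev3 := (tendsto_rpow_neg_atTop (y := (1:ℝ) / (3 + m)) (by positivity)).eventually_lt_const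
    ha
  obtain ⟨α₀, hα₀⟩ := Filter.eventually_atTop.1 (hev1.and (hev2.and hev3))
  refine ⟨L + K, max α₀ 1, by positivity, lt_max_of_lt_right one_pos, fun α hα => ?_⟩
  obtain ⟨h1, h2, h3⟩ := hα₀ α ((le_max_left _ _).trans hα.le)
  have hα0 : 0 < α := one_pos.trans ((le_max_right _ _).trans_lt hα)
  set δ : ℝ := α ^ (-((1:ℝ) / (3 + m))) with hδ_def
  have hδ : 0 < δ := Real.rpow_pos_of_pos hα0 _
  have hpow : ∀ k : ℕ, α * δ ^ k = α ^ ((3 + m - k : ℝ) / (3 + m)) := fun k => by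
    rw [hδ_def, ← Real.rpow_mul_natCast hα0.le]
    nth_rewrite 1 [← Real.rpow_one α]
    rw [← Real.rpow_add hα0]
    congr 1
    field_simp
    ring
  have hδm : α * δ ^ m = α ^ ((3:ℝ) / (3 + m)) := by
    rw [hpow]
    congr 2
    ring
  have hδm1 : α * δ ^ (m + 1) = α ^ ((2:ℝ) / (3 + m)) := by
    rw [hpow]
    congr 2
    push_cast
    ring
  have hδ2 : (δ ^ 2)⁻¹ = α ^ ((2:ℝ) / (3 + m)) := by
    rw [hδ_def, ← Real.rpow_mul_natCast hα0.le, ← Real.rpow_neg hα0.le]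
    congr 1
    push_cast
    ring
  obtain ⟨θ, hθ, hθ0, hθ1, hκ⟩ := hcut δ hδ
  rw [hδ2] at hκ
  have hp : 0 < α ^ ((2:ℝ) / (3 + m)) := Real.rpow_pos_of_pos hα0 _
  rw [← hscale α hα0] at h1 ⊢
  refine (abs_EDU_sub_ES_le hn (ε := K * α ^ ((2:ℝ) / (3 + m))) hU.continuousOn hb hbc hα0 hδ
    h3.le (mul_pos hL hp).le (mul_pos hK hp).le hUb (fun t ht => ?_) hθ hθ0 hθ1 hκ ?_).trans
    (by linarith)
  · calc |α * U t - c * α * t ^ m| = α * |U t - c * t ^ m| := by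
          rw [← abs_of_pos hα0, ← abs_mul, abs_of_pos hα0]
          ring_nf
      _ ≤ α * (K * t ^ (m + 1)) :=
          mul_le_mul_of_nonneg_left (hT t ⟨ht.1, ht.2.trans h3.le⟩) hα0.le
      _ ≤ α * (K * δ ^ (m + 1)) := by
          gcongr
          exacts [ht.1, ht.2]
      _ = K * α ^ ((2:ℝ) / (3 + m)) := by rw [← hδm1]; ring
  · have e : α * (b * (δ / 2) ^ m) = b / 2 ^ m * α ^ ((3:ℝ) / (3 + m)) := by
      rw [← hδm, div_pow]
      ring
    rw [e]
    linarith
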